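/- Let n = 3. If a mechanism φ is neutral, strategy-proof, and envy-free, then no agent is allocated any object fully at any preference profile: for every profile ≻, every agent i, and every object a, φ(≻)_{i,a} < 1. -/

import Mathlib

open Finset

/-- A preference over `n` objects, encoded by its rank function:
`r a` is the (0-based) rank of object `a`; object `a` is strictly preferred to `b`
iff `r a < r b`.  The `k`-th ranked object (0-based) is `r.symm k`. -/
abbrev Pref (n : ℕ) := Fin n ≃ Fin n

/-- The total probability that allocation `p` assigns to the upper contour set of `a`
(the objects weakly preferred to `a`) under preference `r`. -/
def upperSum {n : ℕ} (r : Pref n) (p : Fin n → ℝ) (a : Fin n) : ℝ :=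
  ∑ o ∈ Finset.univ.filter (fun o => r o ≤ r a), p o

/-- First-order stochastic dominance of `p` over `q` with respect to preference `r`. -/
def StochDom {n : ℕ} (r : Pref n) (p q : Fin n → ℝ) : Prop :=
  ∀ a : Fin n, upperSum r q a ≤ upperSum r p a

/-- A random assignment: a doubly stochastic matrix. -/
def IsRandomAssignment {n : ℕ} (P : Matrix (Fin n) (Fin n) ℝ) : Prop :=
  (∀ i a, 0 ≤ P i a) ∧ (∀ i, ∑ a, P i a = 1) ∧ (∀ a, ∑ i, P i a = 1)

/-- A mechanism maps every preference profile to a random assignment. -/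
def IsMechanism {n : ℕ} (φ : (Fin n → Pref n) → Matrix (Fin n) (Fin n) ℝ) : Prop :=
  ∀ prof, IsRandomAssignment (φ prof)

/-- Strategy-proofness: no agent can ever benefit (in the stochastic dominance sense)
from misreporting her preference. -/
def StrategyProof {n : ℕ} (φ : (Fin n → Pref n) → Matrix (Fin n) (Fin n) ℝ) : Prop :=
  ∀ (prof : Fin n → Pref n) (i : Fin n) (r' : Pref n),
    StochDom (prof i) (φ prof i) (φ (Function.update prof i r') i)

/-- Envy-freeness: each agent's allocation stochastically dominates every other
agent's allocation with respect to her own preference. -/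
def EnvyFree {n : ℕ} (φ : (Fin n → Pref n) → Matrix (Fin n) (Fin n) ℝ) : Prop :=
  ∀ (prof : Fin n → Pref n) (i j : Fin n), StochDom (prof i) (φ prof i) (φ prof j)

/-- Relabeling of a preference by a permutation `π` of objects: the rank of `π a`
in `relabel π r` equals the rank of `a` in `r`. -/
def relabel {n : ℕ} (π : Equiv.Perm (Fin n)) (r : Pref n) : Pref n :=
  π.symm.trans r

/-- Neutrality of a mechanism: invariance under relabeling of the objects. -/
def Neutral {n : ℕ} (φ : (Fin n → Pref n) → Matrix (Fin n) (Fin n) ℝ) : Prop :=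
  ∀ (prof : Fin n → Pref n) (π : Equiv.Perm (Fin n)) (i a : Fin n),
    φ (fun j => relabel π (prof j)) i (π a) = φ prof i a

namespace StochDom

variable {r : Pref 3} {p q : Fin 3 → ℝ}

lemma top_le (h : StochDom r p q) {x : Fin 3} (hx : r x = 0) : q x ≤ p x := by
  have hs : (univ.filter fun o => r o ≤ r x) = {x} := by
    ext o
    simp only [mem_filter, mem_univ, true_and, mem_singleton, hx, Fin.le_zero_iff]
    rw [← hx, r.injective.eq_iff]
  simpa only [upperSum, hs, sum_singleton] using h x

lemma bottom_le (h : StochDom r p q) (hp : ∑ a, p a = 1) (hq : ∑ a, q a = 1)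
    {x : Fin 3} (hx : r x = 2) : p x ≤ q x := by
  have hs : (univ.filter fun o => r o ≤ r (r.symm 1)) = univ.erase x := by
    ext o
    have : o ≠ x ↔ r o ≠ 2 := by rw [← hx, r.injective.ne_iff]
    simp only [Equiv.apply_symm_apply, mem_filter, mem_univ, true_and, mem_erase, and_true, this]
    generalize r o = y
    fin_cases y <;> decide
  have h1 := h (r.symm 1)
  rw [upperSum, upperSum, hs] at h1
  have h2 := add_sum_erase univ p (mem_univ x)
  have h3 := add_sum_erase univ q (mem_univ x)
  linarith

end StochDom

/-- The profile in which `i` reports `p`, `j` reports `q` and everyone else reports `r`. -/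
def threeProfile (i j : Fin 3) (p q r : Pref 3) : Fin 3 → Pref 3 :=
  fun l => if l = i then p else if l = j then q else r

section Profile

variable {i j k : Fin 3}

lemma exists_ne_and_ne : ∀ a b : Fin 3, ∃ c, a ≠ c ∧ b ≠ c := by
  decide

lemma eq_or_eq_or_eq_of_ne (hij : i ≠ j) (hik : i ≠ k) (hjk : j ≠ k) (l : Fin 3) :
    l = i ∨ l = j ∨ l = k := by
  omega

lemma update_threeProfile_fst (p q r p' : Pref 3) :
    Function.update (threeProfile i j p q r) i p' = threeProfile i j p' q r := by
  funext l
  by_cases hl : l = i <;> simp [threeProfile, hl]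

lemma update_threeProfile_snd (hij : i ≠ j) (p q r q' : Pref 3) :
    Function.update (threeProfile i j p q r) j q' = threeProfile i j p q' r := by
  funext l
  by_cases hl : l = j
  · simp [threeProfile, hl, hij.symm]
  · simp [threeProfile, hl]

lemma update_threeProfile_trd (hij : i ≠ j) (hik : i ≠ k) (hjk : j ≠ k) (p q r r' : Pref 3) :
    Function.update (threeProfile i j p q r) k r' = threeProfile i j p q r' := by
  funext l
  rcases eq_or_eq_or_eq_of_ne hij hik hjk l with rfl | rfl | rfl <;>
    simp [threeProfile, *, Ne.symm]

lemma relabel_threeProfile (π : Equiv.Perm (Fin 3)) (p q r : Pref 3) :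
    (fun l => relabel π (threeProfile i j p q r l)) =
      threeProfile i j (relabel π p) (relabel π q) (relabel π r) := by
  funext l
  simp only [threeProfile]
  split_ifs <;> rfl

lemma eq_threeProfile (hij : i ≠ j) (hik : i ≠ k) (hjk : j ≠ k) (prof : Fin 3 → Pref 3) :
    prof = threeProfile i j (prof i) (prof j) (prof k) := by
  funext l
  rcases eq_or_eq_or_eq_of_ne hij hik hjk l with rfl | rfl | rfl <;>
    simp [threeProfile, *, Ne.symm]

lemma IsRandomAssignment.col_sum {P : Matrix (Fin 3) (Fin 3) ℝ} (hP : IsRandomAssignment P)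
    (hij : i ≠ j) (hik : i ≠ k) (hjk : j ≠ k) (a : Fin 3) : P i a + P j a + P k a = 1 := by
  have hu : (univ : Finset (Fin 3)) = {i, j, k} := by
    ext l
    simpa using eq_or_eq_or_eq_of_ne hij hik hjk l
  rw [← hP.2.2 a, hu, sum_insert (by simp [hij, hik]), sum_pair hjk, add_assoc]

lemma IsRandomAssignment.row_sum {P : Matrix (Fin 3) (Fin 3) ℝ} (hP : IsRandomAssignment P)
    {a b c : Fin 3} (hab : a ≠ b) (hac : a ≠ c) (hbc : b ≠ c) (i : Fin 3) :
    P i a + P i b + P i c = 1 := by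
  have hu : (univ : Finset (Fin 3)) = {a, b, c} := by
    ext l
    simpa using eq_or_eq_or_eq_of_ne hab hac hbc l
  rw [← hP.2.1 i, hu, sum_insert (by simp [hab, hac]), sum_pair hbc, add_assoc]

end Profile

section Mechanism

variable {φ : (Fin 3 → Pref 3) → Matrix (Fin 3) (Fin 3) ℝ}

lemma EnvyFree.top_le (hef : EnvyFree φ) (prof : Fin 3 → Pref 3) (i j : Fin 3) {x : Fin 3}
    (hx : prof i x = 0) : φ prof j x ≤ φ prof i x :=
  (hef prof i j).top_le hx

lemma EnvyFree.bottom_le (hef : EnvyFree φ) (hmech : IsMechanism φ) (prof : Fin 3 → Pref 3)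
    (i j : Fin 3) {x : Fin 3} (hx : prof i x = 2) : φ prof i x ≤ φ prof j x :=
  (hef prof i j).bottom_le ((hmech prof).2.1 i) ((hmech prof).2.1 j) hx

lemma StrategyProof.top_le (hsp : StrategyProof φ) (prof : Fin 3 → Pref 3) (i : Fin 3)
    (r : Pref 3) {x : Fin 3} (hx : prof i x = 0) :
    φ (Function.update prof i r) i x ≤ φ prof i x :=
  (hsp prof i r).top_le hx

lemma StrategyProof.bottom_le (hsp : StrategyProof φ) (hmech : IsMechanism φ)
    (prof : Fin 3 → Pref 3) (i : Fin 3) (r : Pref 3) {x : Fin 3} (hx : prof i x = 2) :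
    φ prof i x ≤ φ (Function.update prof i r) i x :=
  (hsp prof i r).bottom_le ((hmech _).2.1 i) ((hmech _).2.1 i) hx

lemma StrategyProof.update_top_eq (hsp : StrategyProof φ) (prof : Fin 3 → Pref 3) (i : Fin 3)
    {r : Pref 3} {x : Fin 3} (hx : prof i x = 0) (hr : r x = 0) :
    φ (Function.update prof i r) i x = φ prof i x := by
  refine le_antisymm (hsp.top_le prof i r hx) ?_
  have h := hsp.top_le (Function.update prof i r) i (prof i) (x := x) (by simpa using hr)
  simpa using h

lemma StrategyProof.update_bottom_eq (hsp : StrategyProof φ) (hmech : IsMechanism φ)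
    (prof : Fin 3 → Pref 3) (i : Fin 3) {r : Pref 3} {x : Fin 3} (hx : prof i x = 2)
    (hr : r x = 2) : φ (Function.update prof i r) i x = φ prof i x := by
  refine le_antisymm ?_ (hsp.bottom_le hmech prof i r hx)
  have h := hsp.bottom_le hmech (Function.update prof i r) i (prof i) (x := x) (by simpa using hr)
  simpa using h

/-- At the profile `abc, bca, bca`, the first agent gets `a` with probability at most `2 / 3`. -/
lemma apply_threeProfile_rotate_le (hmech : IsMechanism φ) (hneutral : Neutral φ)
    (hsp : StrategyProof φ) (hef : EnvyFree φ) {i j k : Fin 3}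
    (hij : i ≠ j) (hik : i ≠ k) (hjk : j ≠ k) :
    φ (threeProfile i j (Equiv.refl _) (finRotate 3).symm (finRotate 3).symm) i 0 ≤ 2 / 3 := by
  obtain ⟨abc, habc⟩ : ∃ r : Pref 3, r = Equiv.refl _ := ⟨_, rfl⟩
  obtain ⟨acb, hacb⟩ : ∃ r : Pref 3, r = Equiv.swap 1 2 := ⟨_, rfl⟩
  obtain ⟨bac, hbac⟩ : ∃ r : Pref 3, r = Equiv.swap 0 1 := ⟨_, rfl⟩
  obtain ⟨bca, hbca⟩ : ∃ r : Pref 3, r = (finRotate 3).symm := ⟨_, rfl⟩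
  obtain ⟨cab, hcab⟩ : ∃ r : Pref 3, r = finRotate 3 := ⟨_, rfl⟩
  rw [← habc, ← hbca]
  have hi : ∀ p q r, threeProfile i j p q r i = p := fun p q r => by simp [threeProfile]
  have hj : ∀ p q r, threeProfile i j p q r j = q := fun p q r => by
    simp [threeProfile, hij.symm]
  have hk : ∀ p q r, threeProfile i j p q r k = r := fun p q r => by
    simp [threeProfile, hik.symm, hjk.symm]
  have abc0 : abc 0 = 0 := by rw [habc]; decide
  have abc2 : abc 2 = 2 := by rw [habc]; decide
  have acb0 : acb 0 = 0 := by rw [hacb]; decide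
  have acb1 : acb 1 = 2 := by rw [hacb]; decide
  have bac1 : bac 1 = 0 := by rw [hbac]; decide
  have bca1 : bca 1 = 0 := by rw [hbca]; decide
  have cab1 : cab 1 = 2 := by rw [hcab]; decide
  set T := threeProfile i j with hT
  -- strategy-proofness
  have s₁ := hsp.bottom_le hmech (T abc cab cab) k acb (x := 1) (by rw [hk, cab1])
  have s₂ := hsp.top_le (T abc bca bac) k bca (x := 1) (by rw [hk, bac1])
  have s₃ := hsp.top_le (T abc cab cab) i acb (x := 0) (by rw [hi, abc0])
  have s₄ := hsp.bottom_le hmech (T abc acb acb) i bac (x := 2) (by rw [hi, abc2])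
  have s₅ := hsp.bottom_le hmech (T abc cab acb) j acb (x := 1) (by rw [hj, cab1])
  have s₆ := hsp.top_le (T abc bac bac) j bca (x := 1) (by rw [hj, bac1])
  rw [update_threeProfile_trd hij hik hjk, ← hT] at s₁ s₂
  rw [update_threeProfile_fst, ← hT] at s₃ s₄
  rw [update_threeProfile_snd hij, ← hT] at s₅ s₆
  -- neutrality
  have n₁ := hneutral (T abc bac bac) (Equiv.swap 1 2) i 0
  have n₂ := hneutral (T abc bca bca) (Equiv.swap 0 1) i 2
  rw [relabel_threeProfile, ← hT, show relabel (Equiv.swap 1 2) abc = acb by subst_vars; decide,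
    show relabel (Equiv.swap 1 2) bac = cab by subst_vars; decide,
    show Equiv.swap (1 : Fin 3) 2 0 = 0 by decide] at n₁
  rw [relabel_threeProfile, ← hT, show relabel (Equiv.swap 0 1) abc = bac by subst_vars; decide,
    show relabel (Equiv.swap 0 1) bca = acb by subst_vars; decide,
    show Equiv.swap (0 : Fin 3) 1 2 = 2 by decide] at n₂
  -- envy-freeness
  have e₁ := hef.bottom_le hmech (T abc bac bac) i j (x := 2) (by rw [hi, abc2])
  have e₂ := hef.bottom_le hmech (T abc bac bac) i k (x := 2) (by rw [hi, abc2])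
  have e₃ := hef.bottom_le hmech (T abc cab acb) k j (x := 1) (by rw [hk, acb1])
  have e₄ := hef.top_le (T abc bca bca) k j (x := 1) (by rw [hk, bca1])
  have e₅ := hef.top_le (T abc acb acb) k j (x := 0) (by rw [hk, acb0])
  have e₆ := hef.top_le (T abc bca bac) j k (x := 1) (by rw [hj, bca1])
  have e₇ := hef.bottom_le hmech (T abc acb acb) j k (x := 1) (by rw [hj, acb1])
  have e₈ := hef.top_le (T abc acb acb) j i (x := 0) (by rw [hj, acb0])
  have e₉ := hef.top_le (T abc bac bac) k j (x := 1) (by rw [hk, bac1])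
  have e₁₀ := hef.bottom_le hmech (T abc cab cab) j k (x := 1) (by rw [hj, cab1])
  -- feasibility
  have f := (hmech (T abc cab cab)).1 i 2
  have row := fun q r => (hmech (T abc q r)).row_sum (a := 0) (b := 1) (c := 2)
    (by decide) (by decide) (by decide)
  have col := fun q r => (hmech (T abc q r)).col_sum hij hik hjk
  linarith [row cab cab i, row cab cab j, row cab cab k, col cab cab 0, col cab cab 1,
    row bac bac i, row bac bac j, row bac bac k, col bac bac 0, col bac bac 1,
    row bca bac i, row bca bac j, row bca bac k, col bca bac 0, col bca bac 1,
    row cab acb i, row cab acb j, row cab acb k, col cab acb 0, col cab acb 1,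
    row bca bca i, row bca bca j, row bca bca k, col bca bca 0, col bca bca 1,
    row acb acb i, row acb acb j, row acb acb k, col acb acb 0, col acb acb 1]

lemma IsRandomAssignment.eq_zero_of_eq_one_col {P : Matrix (Fin 3) (Fin 3) ℝ}
    (hP : IsRandomAssignment P) {i j a : Fin 3} (h : P i a = 1) (hij : i ≠ j) : P j a = 0 := by
  obtain ⟨k, hik, hjk⟩ := exists_ne_and_ne i j
  linarith [hP.col_sum hij hik hjk a, hP.1 j a, hP.1 k a]

lemma IsRandomAssignment.eq_zero_of_eq_one_row {P : Matrix (Fin 3) (Fin 3) ℝ}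
    (hP : IsRandomAssignment P) {i a b : Fin 3} (h : P i a = 1) (hab : a ≠ b) : P i b = 0 := by
  obtain ⟨c, hac, hbc⟩ := exists_ne_and_ne a b
  linarith [hP.row_sum hab hac hbc i, hP.1 i b, hP.1 i c]

lemma EnvyFree.rank_eq_zero_of_eq_one (hef : EnvyFree φ) (hmech : IsMechanism φ)
    {prof : Fin 3 → Pref 3} {i a : Fin 3} (h : φ prof i a = 1) : prof i a = 0 := by
  by_contra ha
  set t := (prof i).symm 0 with ht
  have hat : a ≠ t := fun hat => ha (by rw [hat, ht, Equiv.apply_symm_apply])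
  have h0 := (hmech prof).eq_zero_of_eq_one_row h hat
  have hsum := (hmech prof).2.2 t
  have hle : ∑ l, φ prof l t ≤ ∑ _l : Fin 3, 0 :=
    sum_le_sum fun l _ => h0 ▸ hef.top_le prof i l (by simp [ht])
  rw [sum_const_zero] at hle
  linarith

/-- An object that all other agents rank last is not fully allocated. -/
lemma apply_ne_one_of_rank_eq_two (hmech : IsMechanism φ) (hneutral : Neutral φ)
    (hsp : StrategyProof φ) (hef : EnvyFree φ) {prof : Fin 3 → Pref 3} {i j k a : Fin 3}
    (hij : i ≠ j) (hik : i ≠ k) (hjk : j ≠ k) (hj : prof j a = 2) (hk : prof k a = 2) :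
    φ prof i a ≠ 1 := by
  intro h
  have hi := hef.rank_eq_zero_of_eq_one hmech h
  -- let `k` copy the report of `j`
  have hk' : φ (Function.update prof k (prof j)) k a = 0 := by
    rw [hsp.update_bottom_eq hmech prof k hk hj]
    exact (hmech prof).eq_zero_of_eq_one_col h hik
  have hj' : φ (Function.update prof k (prof j)) j a ≤ 0 :=
    hk' ▸ hef.bottom_le hmech _ j k (by simpa [hjk] using hj)
  have h1 : 1 ≤ φ (Function.update prof k (prof j)) i a := by
    linarith [(hmech (Function.update prof k (prof j))).col_sum hij hik hjk a]
  -- let `i` rank the other two objects as `j` does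
  set s : Pref 3 := (prof j).trans (finRotate 3) with hs
  have hsa : s a = 0 := by rw [hs, Equiv.trans_apply, hj]; decide
  rw [← hsp.update_top_eq _ i (by simpa [hik] using hi) hsa] at h1
  have hprof : Function.update (Function.update prof k (prof j)) i s =
      threeProfile i j s (prof j) (prof j) := by
    rw [eq_threeProfile hij hik hjk (Function.update (Function.update prof k (prof j)) i s)]
    simp [hij.symm, hik.symm, hjk]
  rw [hprof, ← hneutral _ s, relabel_threeProfile, hsa] at h1
  have h₁ : relabel s s = Equiv.refl _ := by ext; simp [relabel]
  have h₂ : relabel s (prof j) = (finRotate 3).symm := by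
    ext x
    simp [relabel, hs]
  rw [h₁, h₂] at h1
  linarith [apply_threeProfile_rotate_le hmech hneutral hsp hef hij hik hjk]

/-- If some agent gets an object fully, then so does every agent. -/
lemma exists_apply_eq_one (hmech : IsMechanism φ) (hneutral : Neutral φ)
    (hsp : StrategyProof φ) (hef : EnvyFree φ) {prof : Fin 3 → Pref 3} {i a : Fin 3}
    (h : φ prof i a = 1) (j : Fin 3) : ∃ b, φ prof j b = 1 := by
  have key : ∀ l, i ≠ l → prof l a ≠ 2 → ∃ b ≠ a, φ prof l b = 1 := by
    intro l hil hl
    have h0 := (hmech prof).eq_zero_of_eq_one_col h hil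
    set c := (prof l).symm 2 with hc
    have hlc : prof l c = 2 := by simp [hc]
    have hac : a ≠ c := fun hac => hl (hac ▸ hlc)
    obtain ⟨b, hab, hcb⟩ := exists_ne_and_ne a c
    refine ⟨b, hab.symm, ?_⟩
    have hle := hef.bottom_le hmech prof l i hlc
    rw [(hmech prof).eq_zero_of_eq_one_row h hac] at hle
    linarith [(hmech prof).row_sum hab hac hcb.symm l, (hmech prof).1 l c]
  by_cases hij : i = j
  · exact ⟨a, hij ▸ h⟩
  obtain ⟨k, hik, hjk⟩ := exists_ne_and_ne i j
  by_cases hj : prof j a = 2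
  · by_cases hk : prof k a = 2
    · exact absurd h (apply_ne_one_of_rank_eq_two hmech hneutral hsp hef hij hik hjk hj hk)
    · obtain ⟨b, hba, hb⟩ := key k hik hk
      obtain ⟨c, hac, hbc⟩ := exists_ne_and_ne a b
      refine ⟨c, ?_⟩
      linarith [(hmech prof).row_sum hba.symm hac hbc j,
        (hmech prof).eq_zero_of_eq_one_col h hij, (hmech prof).eq_zero_of_eq_one_col hb hjk.symm]
  · obtain ⟨b, -, hb⟩ := key j hij hj
    exact ⟨b, hb⟩

/-- If `i` gets `a` fully, another agent can be made to rank `a` last without changing that. -/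
lemma exists_update_apply_eq_one (hmech : IsMechanism φ) (hneutral : Neutral φ)
    (hsp : StrategyProof φ) (hef : EnvyFree φ) {prof : Fin 3 → Pref 3} {i j a : Fin 3}
    (hij : i ≠ j) (h : φ prof i a = 1) :
    ∃ r : Pref 3, r a = 2 ∧ φ (Function.update prof j r) i a = 1 := by
  obtain ⟨b, hb⟩ := exists_apply_eq_one hmech hneutral hsp hef h j
  have hba : b ≠ a := by
    rintro rfl
    linarith [(hmech prof).eq_zero_of_eq_one_col h hij]
  obtain ⟨r, hrb, hra⟩ : ∃ r : Pref 3, r b = 0 ∧ r a = 2 := by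
    clear h hb
    decide +revert
  refine ⟨r, hra, ?_⟩
  have hb' := hsp.update_top_eq prof j (hef.rank_eq_zero_of_eq_one hmech hb) hrb
  rw [hb] at hb'
  obtain ⟨c, hc⟩ := exists_apply_eq_one hmech hneutral hsp hef hb' i
  have hca : c = a := by
    apply (prof i).injective
    rw [hef.rank_eq_zero_of_eq_one hmech h]
    simpa [hij] using hef.rank_eq_zero_of_eq_one hmech hc
  rwa [← hca]

end Mechanism

/-- For `n = 3`, a neutral, strategy-proof and envy-free mechanism never allocates
any object fully to any agent at any profile. -/
theorem no_full_allocation_n3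
    (φ : (Fin 3 → Pref 3) → Matrix (Fin 3) (Fin 3) ℝ)
    (hmech : IsMechanism φ) (hneutral : Neutral φ)
    (hsp : StrategyProof φ) (hef : EnvyFree φ) :
    ∀ (prof : Fin 3 → Pref 3) (i a : Fin 3), φ prof i a < 1 := by
  intro prof i a
  have hle : φ prof i a ≤ 1 := by
    rw [← (hmech prof).2.1 i]
    exact single_le_sum (fun b _ => (hmech prof).1 i b) (mem_univ a)
  refine lt_of_le_of_ne hle fun h => ?_
  obtain ⟨j, hij, -⟩ := exists_ne_and_ne i i
  obtain ⟨k, hik, hjk⟩ := exists_ne_and_ne i j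
  obtain ⟨q, hq, h₁⟩ := exists_update_apply_eq_one hmech hneutral hsp hef hij h
  obtain ⟨r, hr, h₂⟩ := exists_update_apply_eq_one hmech hneutral hsp hef hik h₁
  exact apply_ne_one_of_rank_eq_two hmech hneutral hsp hef hij hik hjk
    (by simpa [hjk] using hq) (by simpa using hr) h₂
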